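/- Fix input distributions P_{X_1},…,P_{X_K}, a subset 𝒦′ ⊆ 𝒦 with 𝒦̄′ = 𝒦∖𝒦′, and rates Q_1,…,Q_K ≥ 0. If Q_k = 0 for all k ∈ 𝒦̄′ and ∑_{k∈S} Q_k > I(X_S;Z|X_{𝒦̄′}) for every nonempty S ⊆ 𝒦′ (mutual informations computed for X_𝒦 ~ ∏_k P_{X_k} and Z the corresponding single-letter channel output), then there exist ε > 0 and N such that for every blocklength n ≥ N, the expectation over the random codebooks satisfies E‖P_{Z^n}(·|C_𝒦) − P_{Z^n}(·|C_{𝒦̄′})‖₁ ≤ e^{−nε}. -/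

import Mathlib

open scoped Classical

noncomputable section

/-- Probability that random variable `X` takes value `x`, under pmf `p` on a finite sample space. -/
def probOf {Ω α : Type} [Fintype Ω] (p : Ω → ℝ) (X : Ω → α) (x : α) : ℝ :=
  ∑ ω, if X ω = x then p ω else 0

/-- Shannon entropy (base 2) of a finitely-valued random variable. -/
def Hent {Ω α : Type} [Fintype Ω] [Fintype α] (p : Ω → ℝ) (X : Ω → α) : ℝ :=
  -∑ x, probOf p X x * Real.logb 2 (probOf p X x)

/-- Conditional entropy `H(X | C)`. -/
def condHent {Ω α γ : Type} [Fintype Ω] [Fintype α] [Fintype γ]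
    (p : Ω → ℝ) (X : Ω → α) (C : Ω → γ) : ℝ :=
  Hent p (fun ω => (X ω, C ω)) - Hent p C

/-- Conditional mutual information `I(A;B | C)`. -/
def IcondMut {Ω α β γ : Type} [Fintype Ω] [Fintype α] [Fintype β] [Fintype γ]
    (p : Ω → ℝ) (A : Ω → α) (B : Ω → β) (C : Ω → γ) : ℝ :=
  condHent p A C + condHent p B C - condHent p (fun ω => (A ω, B ω)) C

/-- Mutual information `I(A;B)`. -/
def Imut {Ω α β : Type} [Fintype Ω] [Fintype α] [Fintype β]
    (p : Ω → ℝ) (A : Ω → α) (B : Ω → β) : ℝ :=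
  Hent p A + Hent p B - Hent p (fun ω => (A ω, B ω))

/-- The tuple `X_S = (X_k)_{k ∈ S}` as a random variable. -/
def tup {Ω ι : Type} {𝒳 : ι → Type} (X : ∀ k, Ω → 𝒳 k) (S : Finset ι) :
    Ω → ∀ k : S, 𝒳 k.1 :=
  fun ω k => X k.1 ω

/-- Size of the message set of user `k` at blocklength `n` and rate `Q k`: `⌈2^{n Q_k}⌉`. -/
def Msize {K : ℕ} (Q : Fin K → ℝ) (n : ℕ) (k : Fin K) : ℕ :=
  ⌈(2 : ℝ) ^ ((n : ℝ) * Q k)⌉₊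

/-- `n`-fold memoryless extension of the channel `W`. -/
def Wn {K : ℕ} {𝒳 : Fin K → Type} {𝒵 : Type}
    (W : (∀ k, 𝒳 k) → 𝒵 → ℝ) (n : ℕ) (x : ∀ k, Fin n → 𝒳 k) (z : Fin n → 𝒵) : ℝ :=
  ∏ i, W (fun k => x k i) (z i)

/-- Probability of a realization `c` of the collection of random codebooks. -/
def cbProb {K : ℕ} {𝒳 : Fin K → Type} [∀ k, Fintype (𝒳 k)]
    (P : ∀ k, 𝒳 k → ℝ) (Q : Fin K → ℝ) (n : ℕ)
    (c : ∀ k, Fin (Msize Q n k) → Fin n → 𝒳 k) : ℝ :=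
  ∏ k, ∏ m, ∏ i, P k (c k m i)

/-- Output distribution `P_{Z^n}(·|C_𝒦)` induced by the full collection of codebooks. -/
def PoutFull {K : ℕ} {𝒳 : Fin K → Type} [∀ k, Fintype (𝒳 k)] {𝒵 : Type}
    (W : (∀ k, 𝒳 k) → 𝒵 → ℝ) (Q : Fin K → ℝ) (n : ℕ)
    (c : ∀ k, Fin (Msize Q n k) → Fin n → 𝒳 k) (z : Fin n → 𝒵) : ℝ :=
  (∏ k, (Msize Q n k : ℝ))⁻¹ *
    ∑ m : ∀ k, Fin (Msize Q n k), Wn W n (fun k i => c k (m k) i) z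

/-- Output distribution `P_{Z^n}(·|C_{𝒦̄′})` induced by the codebooks of the users outside `K'`,
with the inputs of users in `K'` drawn i.i.d. from their input distributions. -/
def PoutPartial {K : ℕ} {𝒳 : Fin K → Type} [∀ k, Fintype (𝒳 k)] {𝒵 : Type}
    (W : (∀ k, 𝒳 k) → 𝒵 → ℝ) (P : ∀ k, 𝒳 k → ℝ) (Q : Fin K → ℝ)
    (K' : Finset (Fin K)) (n : ℕ)
    (c : ∀ k, Fin (Msize Q n k) → Fin n → 𝒳 k) (z : Fin n → 𝒵) : ℝ :=
  (∏ k ∈ Finset.univ \ K', (Msize Q n k : ℝ))⁻¹ *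
    ∑ m : ∀ k : (Finset.univ \ K' : Finset (Fin K)), Fin (Msize Q n k.1),
      ∑ x : ∀ k : K', Fin n → 𝒳 k.1,
        (∏ k : K', ∏ i, P k.1 (x k i)) *
          Wn W n (fun k i =>
            if h : k ∈ K' then x ⟨k, h⟩ i
            else c k (m ⟨k, Finset.mem_sdiff.mpr ⟨Finset.mem_univ k, h⟩⟩) i) z


/-- The product weight of a tuple. -/
def prodWeight {ι : Type} [Fintype ι] {A : ι → Type} (p : ∀ k, A k → ℝ) (x : ∀ k, A k) : ℝ :=
  ∏ k, p k (x k)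

/-- Average of `F` over the coordinates outside `U`, drawn independently according to `p`. -/
def condAvg {ι : Type} [Fintype ι] [DecidableEq ι] {A : ι → Type} [∀ k, Fintype (A k)]
    (p : ∀ k, A k → ℝ) (U : Finset ι) (F : (∀ k, A k) → ℝ) (x : ∀ k, A k) : ℝ :=
  ∑ y, prodWeight p y * F (U.piecewise x y)

section ProductWeights

variable {ι : Type} [Fintype ι] [DecidableEq ι] {A : ι → Type} [∀ k, Fintype (A k)]

lemma prodWeight_nonneg {ι : Type} [Fintype ι] {A : ι → Type} [∀ k, Fintype (A k)] {p : ∀ k, A k → ℝ} (hp : ∀ k, (∀ x, 0 ≤ p k x) ∧ ∑ x, p k x = 1)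
    (x : ∀ k, A k) : 0 ≤ prodWeight p x :=
  Finset.prod_nonneg fun k _ => (hp k).1 _

lemma sum_prodWeight {p : ∀ k, A k → ℝ} (hp : ∀ k, (∀ x, 0 ≤ p k x) ∧ ∑ x, p k x = 1) :
    ∑ x, prodWeight p x = 1 := by
  simp only [prodWeight]
  rw [← Fintype.prod_sum]
  exact Finset.prod_eq_one fun k _ => (hp k).2

/-- Marginal of a product weight. -/
lemma sum_prodWeight_indicator {p : ∀ k, A k → ℝ}
    (hp : ∀ k, (∀ x, 0 ≤ p k x) ∧ ∑ x, p k x = 1) (U : Finset ι) (x : ∀ k, A k) :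
    ∑ v, prodWeight p v * (if ∀ k ∈ U, v k = x k then 1 else 0) = ∏ k ∈ U, p k (x k) := by
  have h1 : ∀ v : ∀ k, A k, prodWeight p v * (if ∀ k ∈ U, v k = x k then 1 else 0) =
      ∏ k, (p k (v k) * if k ∈ U → v k = x k then 1 else 0) := by
    intro v
    rw [Finset.prod_mul_distrib, prodWeight]
    congr 1
    by_cases h : ∀ k ∈ U, v k = x k
    · rw [if_pos h]
      exact (Finset.prod_eq_one fun k _ => if_pos (h k)).symm
    · rw [if_neg h]
      push Not at h
      obtain ⟨k, hk, hne⟩ := h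
      exact (Finset.prod_eq_zero (Finset.mem_univ k) (if_neg (by tauto))).symm
  rw [Finset.sum_congr rfl fun v _ => h1 v,
    ← Fintype.prod_sum (fun k a => p k a * if k ∈ U → a = x k then 1 else 0),
    ← Finset.prod_subset (Finset.subset_univ U)]
  · refine Finset.prod_congr rfl fun k hk => ?_
    simp [hk]
  · intro k _ hk
    simp [hk, (hp k).2]

/-- Exchanging the coordinates in `U` between two independent tuples preserves their joint law. -/
lemma sum_prodWeight_swap (p : ∀ k, A k → ℝ) (U : Finset ι)
    (Φ : (∀ k, A k) → (∀ k, A k) → ℝ) :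
    ∑ x, ∑ y, prodWeight p x * prodWeight p y * Φ (U.piecewise x y) (U.piecewise y x) =
      ∑ x, ∑ y, prodWeight p x * prodWeight p y * Φ x y := by
  rw [← Fintype.sum_prod_type', ← Fintype.sum_prod_type']
  have hinv : Function.Involutive
      (fun q : (∀ k, A k) × (∀ k, A k) => (U.piecewise q.1 q.2, U.piecewise q.2 q.1)) := by
    intro q
    ext k <;> by_cases hk : k ∈ U <;> simp [hk]
  refine Fintype.sum_equiv (Function.Involutive.toPerm _ hinv) _ _ fun q => ?_
  simp only [Function.Involutive.coe_toPerm]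
  congr 1
  simp only [prodWeight]
  rw [← Finset.prod_mul_distrib, ← Finset.prod_mul_distrib]
  refine Finset.prod_congr rfl fun k _ => ?_
  by_cases hk : k ∈ U <;> simp [hk, mul_comm]

lemma sum_prodWeight_mul_condAvg {p : ∀ k, A k → ℝ}
    (hp : ∀ k, (∀ x, 0 ≤ p k x) ∧ ∑ x, p k x = 1) (U : Finset ι) (F : (∀ k, A k) → ℝ) :
    ∑ x, prodWeight p x * condAvg p U F x = ∑ x, prodWeight p x * F x := by
  have h := sum_prodWeight_swap p U (fun x _ => F x)
  calc _ = ∑ x, ∑ y, prodWeight p x * prodWeight p y * F (U.piecewise x y) := by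
        simp only [condAvg, Finset.mul_sum, mul_assoc]
    _ = _ := h
    _ = _ := by
        refine Finset.sum_congr rfl fun x _ => ?_
        rw [← Finset.sum_mul, ← Finset.mul_sum, sum_prodWeight hp, mul_one]

/-- Conditioning a product weight on the coordinates in `U`. -/
lemma sum_prodWeight_indicator_mul {p : ∀ k, A k → ℝ}
    (hp : ∀ k, (∀ x, 0 ≤ p k x) ∧ ∑ x, p k x = 1) (U : Finset ι) (F : (∀ k, A k) → ℝ)
    (x : ∀ k, A k) :
    ∑ v, prodWeight p v * ((if ∀ k ∈ U, v k = x k then 1 else 0) * F v) =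
      (∏ k ∈ U, p k (x k)) * condAvg p U F x := by
  rw [← sum_prodWeight_mul_condAvg hp U, ← sum_prodWeight_indicator hp, Finset.sum_mul]
  refine Finset.sum_congr rfl fun v _ => ?_
  rw [mul_assoc]
  congr 1
  simp only [condAvg, Finset.mul_sum]
  refine Finset.sum_congr rfl fun y _ => ?_
  by_cases h : ∀ k ∈ U, v k = x k
  · have e : U.piecewise v y = U.piecewise x y := by
      ext k
      by_cases hk : k ∈ U <;> simp [hk]
      exact h k hk
    rw [e, if_pos h, if_pos]
    · ring
    · intro k hk; simp [hk]
  · rw [if_neg h, if_neg]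
    · ring
    · intro h'
      exact h fun k hk => by simpa [hk] using h' k hk

lemma condAvg_congr (p : ∀ k, A k → ℝ) (U : Finset ι) (F : (∀ k, A k) → ℝ) {x y : ∀ k, A k}
    (h : ∀ k ∈ U, x k = y k) : condAvg p U F x = condAvg p U F y := by
  refine Finset.sum_congr rfl fun v _ => ?_
  congr 2
  ext k
  by_cases hk : k ∈ U <;> simp [hk]
  exact h k hk

lemma condAvg_piecewise (p : ∀ k, A k → ℝ) {B U : Finset ι} (hBU : B ⊆ U) (F : (∀ k, A k) → ℝ)
    (x y : ∀ k, A k) : condAvg p B F (U.piecewise x y) = condAvg p B F x :=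
  condAvg_congr p B F fun k hk => by simp [hBU hk]

lemma condAvg_mono {p : ∀ k, A k → ℝ} (hp : ∀ k, (∀ x, 0 ≤ p k x) ∧ ∑ x, p k x = 1)
    (U : Finset ι) {F G : (∀ k, A k) → ℝ} (h : ∀ x, F x ≤ G x) (x : ∀ k, A k) :
    condAvg p U F x ≤ condAvg p U G x :=
  Finset.sum_le_sum fun y _ => mul_le_mul_of_nonneg_left (h _) (prodWeight_nonneg hp y)

lemma condAvg_nonneg {p : ∀ k, A k → ℝ} (hp : ∀ k, (∀ x, 0 ≤ p k x) ∧ ∑ x, p k x = 1)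
    (U : Finset ι) {F : (∀ k, A k) → ℝ} (h : ∀ x, 0 ≤ F x) (x : ∀ k, A k) :
    0 ≤ condAvg p U F x :=
  Finset.sum_nonneg fun y _ => mul_nonneg (prodWeight_nonneg hp y) (h _)

lemma condAvg_sub (p : ∀ k, A k → ℝ) (U : Finset ι) (F G : (∀ k, A k) → ℝ) (x : ∀ k, A k) :
    condAvg p U (fun y => F y - G y) x = condAvg p U F x - condAvg p U G x := by
  simp only [condAvg, mul_sub, Finset.sum_sub_distrib]

lemma condAvg_condAvg {p : ∀ k, A k → ℝ} (hp : ∀ k, (∀ x, 0 ≤ p k x) ∧ ∑ x, p k x = 1)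
    {B U : Finset ι} (hBU : B ⊆ U) (F : (∀ k, A k) → ℝ) (x : ∀ k, A k) :
    condAvg p U (condAvg p B F) x = condAvg p B F x := by
  rw [condAvg]
  simp only [condAvg_piecewise p hBU]
  rw [← Finset.sum_mul, sum_prodWeight hp, one_mul]

/-- A factor depending only on the coordinates in `B ⊆ U` can be pulled out of the average. -/
lemma condAvg_mul_of_invariant (p : ∀ k, A k → ℝ) {B U : Finset ι} (hBU : B ⊆ U)
    {w : (∀ k, A k) → ℝ} (hw : ∀ x y, (∀ k ∈ B, x k = y k) → w x = w y)
    (F : (∀ k, A k) → ℝ) (x : ∀ k, A k) :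
    condAvg p U (fun y => w y * F y) x = w x * condAvg p U F x := by
  simp only [condAvg, Finset.mul_sum]
  refine Finset.sum_congr rfl fun y _ => ?_
  rw [hw (U.piecewise x y) x fun k hk => by simp [hBU hk]]
  ring

/-- A positive weight at `x` keeps the average of a nonnegative function positive. -/
lemma condAvg_pos {p : ∀ k, A k → ℝ} (hp : ∀ k, (∀ x, 0 ≤ p k x) ∧ ∑ x, p k x = 1)
    (U : Finset ι) {F : (∀ k, A k) → ℝ} (h : ∀ x, 0 ≤ F x) {x : ∀ k, A k}
    (hx : prodWeight p x * F x ≠ 0) : 0 < condAvg p U F x := by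
  have h0 : 0 < prodWeight p x * F x :=
    lt_of_le_of_ne (mul_nonneg (prodWeight_nonneg hp x) (h x)) (Ne.symm hx)
  refine lt_of_lt_of_le h0 ?_
  have := Finset.single_le_sum (f := fun y => prodWeight p y * F (U.piecewise x y))
    (fun y _ => mul_nonneg (prodWeight_nonneg hp y) (h _)) (Finset.mem_univ x)
  have e : U.piecewise x x = x := by ext k; by_cases hk : k ∈ U <;> simp [hk]
  simpa only [condAvg, e] using this

/-- Change of variables for a product weight under a coordinatewise map. -/
lemma sum_prodWeight_comp {D : ι → Type} [∀ k, Fintype (D k)] [∀ k, DecidableEq (D k)] (q : ∀ k, A k → ℝ)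
    (φ : ∀ k, A k → D k) (H : (∀ k, D k) → ℝ) :
    ∑ c, prodWeight q c * H (fun k => φ k (c k)) =
      ∑ b, prodWeight (fun k d => ∑ a, q k a * if φ k a = d then 1 else 0) b * H b := by
  have h1 : ∀ b : ∀ k, D k, prodWeight (fun k d => ∑ a, q k a * if φ k a = d then 1 else 0) b =
      ∑ c, prodWeight q c * if (fun k => φ k (c k)) = b then 1 else 0 := by
    intro b
    simp only [prodWeight]
    rw [Fintype.prod_sum]
    refine Finset.sum_congr rfl fun c _ => ?_
    rw [Finset.prod_mul_distrib]
    congr 1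
    by_cases h : (fun k => φ k (c k)) = b
    · rw [if_pos h]
      exact Finset.prod_eq_one fun k _ => if_pos (congrFun h k)
    · rw [if_neg h]
      obtain ⟨k, hk⟩ := Function.ne_iff.mp h
      exact Finset.prod_eq_zero (Finset.mem_univ k) (if_neg hk)
  simp only [h1, Finset.sum_mul]
  rw [Finset.sum_comm]
  refine Finset.sum_congr rfl fun c _ => ?_
  simp

/-- Joint law of two entries of an i.i.d. codebook. -/
lemma sum_codebook_pair {α : Type} [Fintype α] {p : α → ℝ} (h1 : ∑ x, p x = 1)
    (h0 : ∀ x, 0 ≤ p x) {M : ℕ} (a b : Fin M) (d : α × α) :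
    ∑ c : Fin M → α, (∏ j, p (c j)) * (if (c a, c b) = d then 1 else 0) =
      ∑ q : α × α, (p q.1 * p q.2) * if (q.1, if a = b then q.1 else q.2) = d then 1 else 0 := by
  have hp : ∀ _ : Fin M, (∀ x, 0 ≤ p x) ∧ ∑ x, p x = 1 := fun _ => ⟨h0, h1⟩
  obtain ⟨x, y⟩ := d
  rw [Fintype.sum_prod_type]
  by_cases hab : a = b
  · subst hab
    by_cases hxy : x = y
    · subst hxy
      have := sum_prodWeight_indicator (A := fun _ : Fin M => α) hp {a} (fun _ => x)
      simp only [prodWeight, Finset.mem_singleton, forall_eq, Finset.prod_singleton] at this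
      simpa [← Finset.mul_sum, h1] using this
    · have e1 : ∀ u : α, ¬ (u = x ∧ u = y) := fun u h => hxy (h.1.symm.trans h.2)
      simp [e1]
  · have := sum_prodWeight_indicator (A := fun _ : Fin M => α) hp {a, b}
      (fun k => if k = a then x else y)
    rw [Finset.prod_pair hab] at this
    simp only [prodWeight, Finset.mem_insert, Finset.mem_singleton, forall_eq_or_imp, forall_eq,
      Ne.symm hab, if_true, if_false] at this
    simp only [Prod.mk.injEq, this, hab, if_false]
    simp [ite_and]

/-- Joint law of the codeword tuples selected by two message tuples. -/
lemma sum_codebooks_pair {p : ∀ k, A k → ℝ} (hp : ∀ k, (∀ x, 0 ≤ p k x) ∧ ∑ x, p k x = 1)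
    {M : ι → ℕ} (m m' : ∀ k, Fin (M k)) (F G : (∀ k, A k) → ℝ) :
    ∑ c : ∀ k, Fin (M k) → A k, (∏ k, ∏ j, p k (c k j)) *
        (F (fun k => c k (m k)) * G (fun k => c k (m' k))) =
      ∑ x, prodWeight p x * (F x * condAvg p {k | m k = m' k} G x) := by
  have e1 := sum_prodWeight_comp (A := fun k => Fin (M k) → A k) (D := fun k => A k × A k)
    (fun k c => ∏ j, p k (c j)) (fun k c => (c (m k), c (m' k)))
    (fun b => F (fun k => (b k).1) * G (fun k => (b k).2))
  have e2 := sum_prodWeight_comp (A := fun k => A k × A k) (D := fun k => A k × A k)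
    (fun k q => p k q.1 * p k q.2) (fun k q => (q.1, if m k = m' k then q.1 else q.2))
    (fun b => F (fun k => (b k).1) * G (fun k => (b k).2))
  simp only [sum_codebook_pair (hp _).2 (hp _).1] at e1
  rw [← e2] at e1
  refine e1.trans ?_
  simp only [condAvg, Finset.mul_sum]
  rw [← Fintype.sum_prod_type']
  let e : (∀ k, A k × A k) ≃ (∀ k, A k) × (∀ k, A k) :=
    { toFun := fun b => (fun k => (b k).1, fun k => (b k).2)
      invFun := fun q k => (q.1 k, q.2 k)
      left_inv := fun _ => rfl
      right_inv := fun _ => rfl }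
  refine Fintype.sum_equiv e _ _ fun q => ?_
  have e3 : (fun k => if m k = m' k then (q k).1 else (q k).2) =
      Finset.piecewise {k | m k = m' k} (fun k => (q k).1) (fun k => (q k).2) := by
    ext k
    simp [Finset.piecewise]
  simp only [e, Equiv.coe_fn_mk, prodWeight, Finset.prod_mul_distrib, e3]
  ring

/-- Law of the codeword tuple selected by one message tuple. -/
lemma sum_codebooks_single {p : ∀ k, A k → ℝ} (hp : ∀ k, (∀ x, 0 ≤ p k x) ∧ ∑ x, p k x = 1)
    {M : ι → ℕ} (m : ∀ k, Fin (M k)) (F : (∀ k, A k) → ℝ) :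
    ∑ c : ∀ k, Fin (M k) → A k, (∏ k, ∏ j, p k (c k j)) * F (fun k => c k (m k)) =
      ∑ x, prodWeight p x * F x := by
  have h := sum_codebooks_pair hp m m F (fun _ => 1)
  simpa [condAvg, sum_prodWeight hp] using h

/-- First-moment bound on the deviation of a codebook average from its conditional mean. -/
lemma sum_codebooks_abs_le {p : ∀ k, A k → ℝ} (hp : ∀ k, (∀ x, 0 ≤ p k x) ∧ ∑ x, p k x = 1)
    {M : ι → ℕ} (hM : ∀ k, 0 < M k) (B : Finset ι) {h : (∀ k, A k) → ℝ} (hh : ∀ x, 0 ≤ h x) :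
    ∑ c : ∀ k, Fin (M k) → A k, (∏ k, ∏ j, p k (c k j)) *
        |(∏ k, (M k : ℝ))⁻¹ * ∑ m : ∀ k, Fin (M k),
          (h (fun k => c k (m k)) - condAvg p B h (fun k => c k (m k)))| ≤
      2 * ∑ x, prodWeight p x * h x := by
  have hMp : 0 < ∏ k, (M k : ℝ) := Finset.prod_pos fun k _ => by exact_mod_cast hM k
  have hcard : ∑ _m : ∀ k, Fin (M k), (1 : ℝ) = ∏ k, (M k : ℝ) := by simp
  calc _ ≤ ∑ c : ∀ k, Fin (M k) → A k, (∏ k, ∏ j, p k (c k j)) *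
        ((∏ k, (M k : ℝ))⁻¹ * ∑ m : ∀ k, Fin (M k),
          (h (fun k => c k (m k)) + condAvg p B h (fun k => c k (m k)))) := by
        refine Finset.sum_le_sum fun c _ => mul_le_mul_of_nonneg_left ?_
          (Finset.prod_nonneg fun k _ => Finset.prod_nonneg fun j _ => (hp k).1 _)
        rw [abs_mul, abs_of_pos (inv_pos.mpr hMp)]
        refine mul_le_mul_of_nonneg_left ((Finset.abs_sum_le_sum_abs _ _).trans
          (Finset.sum_le_sum fun m _ => ?_)) (inv_pos.mpr hMp).le
        refine (abs_sub _ _).trans (le_of_eq ?_)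
        rw [abs_of_nonneg (hh _), abs_of_nonneg (condAvg_nonneg hp B hh _)]
    _ = (∏ k, (M k : ℝ))⁻¹ * ∑ m : ∀ k, Fin (M k), ∑ c : ∀ k, Fin (M k) → A k,
          (∏ k, ∏ j, p k (c k j)) *
          (h (fun k => c k (m k)) + condAvg p B h (fun k => c k (m k))) := by
        rw [Finset.sum_comm]
        simp only [Finset.mul_sum]
        refine Finset.sum_congr rfl fun c _ => Finset.sum_congr rfl fun m _ => ?_
        ring
    _ = (∏ k, (M k : ℝ))⁻¹ * ∑ _m : ∀ k, Fin (M k), 1 * (2 * ∑ x, prodWeight p x * h x) := by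
        congr 1
        refine Finset.sum_congr rfl fun m _ => ?_
        rw [sum_codebooks_single hp m (fun x => h x + condAvg p B h x)]
        simp only [mul_add, Finset.sum_add_distrib, sum_prodWeight_mul_condAvg hp]
        ring
    _ = _ := by
        rw [← Finset.sum_mul, hcard, inv_mul_cancel_left₀ hMp.ne']

lemma sum_weighted_covariance_le {p : ∀ k, A k → ℝ}
    (hp : ∀ k, (∀ x, 0 ≤ p k x) ∧ ∑ x, p k x = 1) {B U : Finset ι} (hBU : B ⊆ U)
    {f w : (∀ k, A k) → ℝ} (hf : ∀ x, 0 ≤ f x) (hw : ∀ x, 0 ≤ w x)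
    (hwB : ∀ x y, (∀ k ∈ B, x k = y k) → w x = w y) {l : ℝ}
    (hl : ∀ x, w x * condAvg p U f x ≤ l) :
    ∑ x, prodWeight p x * ((f x - condAvg p B f x) *
        condAvg p U (fun y => w y * (f y - condAvg p B f y)) x) ≤
      l * ∑ x, prodWeight p x * f x := by
  have h1 : ∀ x, condAvg p U (fun y => w y * (f y - condAvg p B f y)) x =
      w x * (condAvg p U f x - condAvg p B f x) := by
    intro x
    rw [condAvg_mul_of_invariant p hBU hwB, condAvg_sub, condAvg_condAvg hp hBU]
  have h2 : ∑ x, prodWeight p x * ((w x * condAvg p B f x) * f x) =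
      ∑ x, prodWeight p x * ((w x * condAvg p B f x) * condAvg p B f x) := by
    rw [← sum_prodWeight_mul_condAvg hp B]
    refine Finset.sum_congr rfl fun x _ => ?_
    rw [condAvg_mul_of_invariant p subset_rfl]
    intro x y h
    rw [hwB x y h, condAvg_congr p B f h]
  have h3 : ∀ x, prodWeight p x * ((f x - condAvg p B f x) *
        condAvg p U (fun y => w y * (f y - condAvg p B f y)) x) ≤
      l * (prodWeight p x * f x) - prodWeight p x * ((w x * condAvg p B f x) * f x) +
        prodWeight p x * ((w x * condAvg p B f x) * condAvg p B f x) := by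
    intro x
    rw [h1]
    have a1 := mul_le_mul_of_nonneg_left (hl x) (mul_nonneg (prodWeight_nonneg hp x) (hf x))
    have a2 : 0 ≤ prodWeight p x * (w x * condAvg p B f x * condAvg p U f x) :=
      mul_nonneg (prodWeight_nonneg hp x) (mul_nonneg (mul_nonneg (hw x)
        (condAvg_nonneg hp B hf x)) (condAvg_nonneg hp U hf x))
    nlinarith
  refine (Finset.sum_le_sum fun x _ => h3 x).trans (le_of_eq ?_)
  rw [Finset.sum_add_distrib, Finset.sum_sub_distrib, h2, Finset.mul_sum]
  ring

/-- Weighted second-moment bound on the deviation of a codebook average from its conditional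
mean. -/
lemma sum_codebooks_sq_le {p : ∀ k, A k → ℝ} (hp : ∀ k, (∀ x, 0 ≤ p k x) ∧ ∑ x, p k x = 1)
    {M : ι → ℕ} (hM : ∀ k, 0 < M k) {B : Finset ι} (hB : ∀ k ∈ B, M k = 1)
    {f w : (∀ k, A k) → ℝ} (hf : ∀ x, 0 ≤ f x) (hw : ∀ x, 0 ≤ w x)
    (hwB : ∀ x y, (∀ k ∈ B, x k = y k) → w x = w y) {l : Finset ι → ℝ} (hl0 : ∀ U, 0 ≤ l U)
    (hl : ∀ U, B ⊂ U → ∀ x, w x * condAvg p U f x ≤ l U) (m₀ : ∀ k, Fin (M k)) :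
    ∑ c : ∀ k, Fin (M k) → A k, (∏ k, ∏ j, p k (c k j)) *
        (w (fun k => c k (m₀ k)) * ((∏ k, (M k : ℝ))⁻¹ * ∑ m : ∀ k, Fin (M k),
          (f (fun k => c k (m k)) - condAvg p B f (fun k => c k (m k)))) ^ 2) ≤
      (∑ U with B ⊂ U, l U / ∏ k ∈ U, (M k : ℝ)) * ∑ x, prodWeight p x * f x := by
  have hMp : 0 < ∏ k, (M k : ℝ) := Finset.prod_pos fun k _ => by exact_mod_cast hM k
  have hE : 0 ≤ ∑ x, prodWeight p x * f x :=
    Finset.sum_nonneg fun x _ => mul_nonneg (prodWeight_nonneg hp x) (hf x)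
  have hfin : ∀ k ∈ B, ∀ a b : Fin (M k), a = b := by
    intro k hk a b
    have := hB k hk
    apply Fin.ext
    have := a.2
    have := b.2
    omega
  set g : (∀ k, A k) → ℝ := fun x => f x - condAvg p B f x with hg
  have hT : ∀ m m' : ∀ k, Fin (M k),
      ∑ x, prodWeight p x * (g x * condAvg p {k | m k = m' k} (fun y => w y * g y) x) ≤
        ∑ U with B ⊂ U, l U * (if ∀ k ∈ U, m' k = m k then 1 else 0) *
          ∑ x, prodWeight p x * f x := by
    intro m m'
    set U : Finset ι := {k | m k = m' k} with hU
    have hBU : B ⊆ U := fun k hk => by simpa [hU] using hfin k hk _ _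
    have hnn : ∀ U', 0 ≤ l U' * (if ∀ k ∈ U', m' k = m k then (1 : ℝ) else 0) *
          ∑ x, prodWeight p x * f x := fun U' =>
      mul_nonneg (mul_nonneg (hl0 _) (by split_ifs <;> norm_num)) hE
    rcases hBU.eq_or_ssubset with h | h
    · refine le_trans (le_of_eq ?_) (Finset.sum_nonneg fun U' _ => hnn U')
      refine Finset.sum_eq_zero fun x _ => ?_
      rw [condAvg_mul_of_invariant p hBU hwB, hg, condAvg_sub, condAvg_condAvg hp hBU, ← h,
        sub_self]
      ring
    · refine (sum_weighted_covariance_le hp hBU hf hw hwB (hl U h)).trans ?_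
      have hs := Finset.single_le_sum (f := fun U' => l U' *
          (if ∀ k ∈ U', m' k = m k then (1 : ℝ) else 0) * ∑ x, prodWeight p x * f x)
        (fun U' _ => hnn U') (show U ∈ ({U | B ⊂ U} : Finset (Finset ι)) by simpa using h)
      refine le_trans (le_of_eq ?_) hs
      rw [if_pos, mul_one]
      intro k hk
      exact ((Finset.mem_filter.mp hk).2).symm
  have hcount : ∀ (m : ∀ k, Fin (M k)) (U : Finset ι),
      (∏ k, (M k : ℝ))⁻¹ * ∑ m' : ∀ k, Fin (M k), (if ∀ k ∈ U, m' k = m k then (1 : ℝ) else 0) =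
        (∏ k ∈ U, (M k : ℝ))⁻¹ := by
    intro m U
    have := sum_prodWeight_indicator (A := fun k => Fin (M k)) (p := fun k _ => (M k : ℝ)⁻¹)
      (fun k => ⟨fun _ => by positivity, by simp [(hM k).ne']⟩) U m
    simp only [prodWeight, Finset.prod_inv_distrib, ← Finset.mul_sum] at this
    convert this
  have hexp : ∀ c : ∀ k, Fin (M k) → A k,
      w (fun k => c k (m₀ k)) * ((∏ k, (M k : ℝ))⁻¹ * ∑ m : ∀ k, Fin (M k),
          g (fun k => c k (m k))) ^ 2 =
        (∏ k, (M k : ℝ))⁻¹ * ∑ m : ∀ k, Fin (M k), (∏ k, (M k : ℝ))⁻¹ * ∑ m' : ∀ k, Fin (M k),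
          g (fun k => c k (m k)) * (w (fun k => c k (m' k)) * g (fun k => c k (m' k))) := by
    intro c
    have hww : ∀ m' : ∀ k, Fin (M k), w (fun k => c k (m' k)) = w (fun k => c k (m₀ k)) :=
      fun m' => hwB _ _ fun k hk => by rw [hfin k hk (m' k) (m₀ k)]
    simp only [hww, ← Finset.mul_sum, ← Finset.sum_mul]
    ring
  calc _ = (∏ k, (M k : ℝ))⁻¹ * ∑ m : ∀ k, Fin (M k), (∏ k, (M k : ℝ))⁻¹ *
        ∑ m' : ∀ k, Fin (M k), ∑ x, prodWeight p x *
          (g x * condAvg p {k | m k = m' k} (fun y => w y * g y) x) := by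
        simp only [← sum_codebooks_pair hp _ _ g (fun y => w y * g y)]
        rw [Finset.sum_congr rfl fun c _ => by rw [hexp c]]
        simp only [Finset.mul_sum]
        rw [Finset.sum_comm]
        refine Finset.sum_congr rfl fun m _ => ?_
        rw [Finset.sum_comm]
        refine Finset.sum_congr rfl fun m' _ => Finset.sum_congr rfl fun c _ => ?_
        ring
    _ ≤ (∏ k, (M k : ℝ))⁻¹ * ∑ m : ∀ k, Fin (M k), (∏ k, (M k : ℝ))⁻¹ *
        ∑ m' : ∀ k, Fin (M k), ∑ U with B ⊂ U, l U * (if ∀ k ∈ U, m' k = m k then 1 else 0) *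
          ∑ x, prodWeight p x * f x := by
        gcongr with m _ m' _
        exact hT m m'
    _ = (∏ k, (M k : ℝ))⁻¹ * ∑ m : ∀ k, Fin (M k),
        (1 : ℝ) * ((∑ U with B ⊂ U, l U / ∏ k ∈ U, (M k : ℝ)) * ∑ x, prodWeight p x * f x) := by
        congr 1
        refine Finset.sum_congr rfl fun m _ => ?_
        rw [Finset.sum_comm, Finset.mul_sum, one_mul, Finset.sum_mul]
        refine Finset.sum_congr rfl fun U _ => ?_
        rw [← Finset.sum_mul, ← Finset.mul_sum, div_eq_mul_inv, ← hcount m U]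
        ring
    _ = _ := by
        rw [← Finset.sum_mul]
        have hcard : ∑ _m : ∀ k, Fin (M k), (1 : ℝ) = ∏ k, (M k : ℝ) := by simp
        rw [hcard, inv_mul_cancel_left₀ hMp.ne']

/-- One-shot soft-covering bound for several independent codebooks. -/
lemma soft_covering_one_shot {p : ∀ k, A k → ℝ}
    (hp : ∀ k, (∀ x, 0 ≤ p k x) ∧ ∑ x, p k x = 1)
    {M : ι → ℕ} (hM : ∀ k, 0 < M k) {B : Finset ι} (hB : ∀ k ∈ B, M k = 1)
    {V : (∀ k, A k) → ℝ} (hV : ∀ x, 0 ≤ V x) {l : Finset ι → ℝ} (hl0 : ∀ U, 0 ≤ l U)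
    {t : ℝ} (ht : 0 < t) :
    ∑ c : ∀ k, Fin (M k) → A k, (∏ k, ∏ j, p k (c k j)) *
        |(∏ k, (M k : ℝ))⁻¹ * ∑ m : ∀ k, Fin (M k),
          (V (fun k => c k (m k)) - condAvg p B V (fun k => c k (m k)))| ≤
      2 * ∑ x, prodWeight p x * (if condAvg p B V x = 0 ∨
          ∃ U, B ⊂ U ∧ l U * condAvg p B V x < condAvg p U V x then V x else 0) +
        (t + t⁻¹ * ∑ U with B ⊂ U, l U / ∏ k ∈ U, (M k : ℝ)) * ∑ x, prodWeight p x * V x := by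
  set bad : (∀ k, A k) → Prop := fun x => condAvg p B V x = 0 ∨
          ∃ U, B ⊂ U ∧ l U * condAvg p B V x < condAvg p U V x with hbad
  set h : (∀ k, A k) → ℝ := fun x => if bad x then V x else 0 with hh
  set f : (∀ k, A k) → ℝ := fun x => if bad x then 0 else V x with hfdef
  have hVB := condAvg_nonneg hp B hV
  have hh0 : ∀ x, 0 ≤ h x := fun x => by simp only [hh]; split_ifs <;> simp [hV]
  have hf0 : ∀ x, 0 ≤ f x := fun x => by simp only [hfdef]; split_ifs <;> simp [hV]
  have hfV : ∀ x, f x ≤ V x := fun x => by simp only [hfdef]; split_ifs <;> simp [hV]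
  have hsum : ∀ x, V x = f x + h x := fun x => by simp only [hfdef, hh]; split_ifs <;> simp
  have hsumB : ∀ x, condAvg p B V x = condAvg p B f x + condAvg p B h x := fun x => by
    simp only [condAvg, ← Finset.sum_add_distrib, ← mul_add, ← hsum]
  have hfz : ∀ x, condAvg p B V x = 0 → f x = 0 := fun x hx => if_pos (Or.inl hx)
  have hfBz : ∀ x, condAvg p B V x = 0 → condAvg p B f x = 0 := fun x hx =>
    le_antisymm ((condAvg_mono hp B hfV x).trans hx.le) (condAvg_nonneg hp B hf0 x)
  have hl : ∀ U, B ⊂ U → ∀ x, (condAvg p B V x)⁻¹ * condAvg p U f x ≤ l U := by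
    intro U hU x
    rcases (hVB x).eq_or_lt with h0 | h0
    · rw [← h0, inv_zero, zero_mul]; exact hl0 U
    rw [inv_mul_le_iff₀ h0, mul_comm]
    by_cases hx : condAvg p U V x ≤ l U * condAvg p B V x
    · exact (condAvg_mono hp U hfV x).trans hx
    · have : condAvg p U f x = 0 := Finset.sum_eq_zero fun y _ => by
        have hb : bad (U.piecewise x y) := Or.inr ⟨U, hU, by
          rw [condAvg_piecewise p hU.subset, condAvg_piecewise p subset_rfl]
          exact not_le.mp hx⟩
        simp [hfdef, hb]
      rw [this]
      exact mul_nonneg (hl0 U) h0.le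
  let m₀ : ∀ k, Fin (M k) := fun k => ⟨0, hM k⟩
  have hwB : ∀ x y : ∀ k, A k, (∀ k ∈ B, x k = y k) →
      (condAvg p B V x)⁻¹ = (condAvg p B V y)⁻¹ := fun x y hxy => by
    rw [condAvg_congr p B V hxy]
  have hcB : ∀ (c : ∀ k, Fin (M k) → A k) (m : ∀ k, Fin (M k)),
      condAvg p B V (fun k => c k (m k)) = condAvg p B V (fun k => c k (m₀ k)) := by
    refine fun c m => condAvg_congr p B V fun k hk => congrArg (c k) (Fin.ext ?_)
    have h1 := hB k hk
    have h2 := (m k).2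
    have h3 := (m₀ k).2
    omega
  have hc0 : ∀ c : ∀ k, Fin (M k) → A k, 0 ≤ ∏ k, ∏ j, p k (c k j) := fun c =>
    Finset.prod_nonneg fun k _ => Finset.prod_nonneg fun j _ => (hp k).1 _
  have hpt : ∀ c : ∀ k, Fin (M k) → A k,
      |(∏ k, (M k : ℝ))⁻¹ * ∑ m : ∀ k, Fin (M k),
          (V (fun k => c k (m k)) - condAvg p B V (fun k => c k (m k)))| ≤
        |(∏ k, (M k : ℝ))⁻¹ * ∑ m : ∀ k, Fin (M k),
          (h (fun k => c k (m k)) - condAvg p B h (fun k => c k (m k)))| +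
        (t * condAvg p B V (fun k => c k (m₀ k)) +
          t⁻¹ * ((condAvg p B V (fun k => c k (m₀ k)))⁻¹ *
            ((∏ k, (M k : ℝ))⁻¹ * ∑ m : ∀ k, Fin (M k),
          (f (fun k => c k (m k)) - condAvg p B f (fun k => c k (m k)))) ^ 2)) := by
    intro c
    set D := (∏ k, (M k : ℝ))⁻¹ * ∑ m : ∀ k, Fin (M k),
          (f (fun k => c k (m k)) - condAvg p B f (fun k => c k (m k))) with hD
    have e : (∏ k, (M k : ℝ))⁻¹ * ∑ m : ∀ k, Fin (M k),
          (V (fun k => c k (m k)) - condAvg p B V (fun k => c k (m k))) =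
        (∏ k, (M k : ℝ))⁻¹ * ∑ m : ∀ k, Fin (M k),
          (h (fun k => c k (m k)) - condAvg p B h (fun k => c k (m k))) + D := by
      rw [hD, ← mul_add, ← Finset.sum_add_distrib]
      congr 1
      refine Finset.sum_congr rfl fun m _ => ?_
      rw [hsum, hsumB]
      ring
    rw [e]
    refine (abs_add_le _ _).trans (add_le_add le_rfl ?_)
    rcases (hVB (fun k => c k (m₀ k))).eq_or_lt with h0 | h0
    · have : D = 0 := by
        rw [hD, Finset.sum_eq_zero, mul_zero]
        intro m _
        have hz := (hcB c m).trans h0.symm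
        rw [hfz _ hz, hfBz _ hz, sub_zero]
      rw [this, ← h0]
      simp
    · set P := condAvg p B V (fun k => c k (m₀ k))
      have h1 : t⁻¹ * (P⁻¹ * D ^ 2) = D ^ 2 / (t * P) := by field_simp
      have htP : 0 < t * P := mul_pos ht h0
      rw [h1, ← sub_le_iff_le_add', le_div_iff₀ htP, ← sq_abs]
      nlinarith [sq_nonneg (|D| - t * P), abs_nonneg D]
  calc _ ≤ ∑ c : ∀ k, Fin (M k) → A k, (∏ k, ∏ j, p k (c k j)) * _ :=
        Finset.sum_le_sum fun c _ => mul_le_mul_of_nonneg_left (hpt c) (hc0 c)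
    _ ≤ 2 * ∑ x, prodWeight p x * h x + (t * ∑ x, prodWeight p x * V x +
        t⁻¹ * ((∑ U with B ⊂ U, l U / ∏ k ∈ U, (M k : ℝ)) * ∑ x, prodWeight p x * f x)) := by
        simp only [mul_add, Finset.sum_add_distrib]
        refine add_le_add (sum_codebooks_abs_le hp hM B hh0) (add_le_add (le_of_eq ?_) ?_)
        · rw [← sum_prodWeight_mul_condAvg hp B V, ← sum_codebooks_single hp m₀, Finset.mul_sum]
          exact Finset.sum_congr rfl fun c _ => by ring
        · have := mul_le_mul_of_nonneg_left (sum_codebooks_sq_le hp hM hB hf0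
            (fun x => inv_nonneg.mpr (hVB x)) hwB hl0 hl m₀) (inv_pos.mpr ht).le
          refine le_trans (le_of_eq ?_) this
          rw [Finset.mul_sum]
          exact Finset.sum_congr rfl fun c _ => by ring
    _ ≤ _ := by
        have h1 : ∑ x, prodWeight p x * f x ≤ ∑ x, prodWeight p x * V x :=
          Finset.sum_le_sum fun x _ =>
            mul_le_mul_of_nonneg_left (hfV x) (prodWeight_nonneg hp x)
        have h2 : 0 ≤ ∑ U with B ⊂ U, l U / ∏ k ∈ U, (M k : ℝ) :=
          Finset.sum_nonneg fun U _ => div_nonneg (hl0 U) (by positivity)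
        have h3 := mul_le_mul_of_nonneg_left (mul_le_mul_of_nonneg_left h1 h2)
          (inv_pos.mpr ht).le
        linarith

/-- The weight of a partial tuple is the marginal of the product weight. -/
lemma sum_prodWeight_restrict {p : ∀ k, A k → ℝ}
    (hp : ∀ k, (∀ x, 0 ≤ p k x) ∧ ∑ x, p k x = 1) (T : Finset ι) (G : (∀ k : T, A k.1) → ℝ) :
    ∑ y, prodWeight p y * G (fun k => y k.1) =
      ∑ x : ∀ k : T, A k.1, (∏ k : T, p k.1 (x k)) * G x := by
  rw [Fintype.sum_equiv (Equiv.piEquivPiSubtypeProd (· ∈ T) A) _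
    (fun q => (∏ k : {k // k ∈ T}, p k.1 (q.1 k)) * (∏ k : {k // k ∉ T}, p k.1 (q.2 k)) * G q.1)]
  · rw [Fintype.sum_prod_type]
    refine Finset.sum_congr rfl fun x _ => ?_
    dsimp only
    rw [← Finset.sum_mul, ← Finset.mul_sum,
      ← Fintype.prod_sum (fun (k : {k // k ∉ T}) a => p k.1 a),
      Finset.prod_eq_one fun (k : {k // k ∉ T}) _ => (hp k.1).2, mul_one]
  · intro y
    rw [prodWeight, ← Fintype.prod_subtype_mul_prod_subtype (· ∈ T)]
    exact congrArg₂ _ (congrArg₂ _ (Finset.prod_congr (by ext; simp) fun _ _ => rfl) rfl) rfl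

end ProductWeights

section Blocks

variable {ι : Type} [Fintype ι] {A : ι → Type}

/-- The i.i.d. law of a block of length `n`. -/
def blockLaw {ι : Type} {A : ι → Type} (p : ∀ k, A k → ℝ) (n : ℕ) (k : ι) (a : Fin n → A k) : ℝ :=
  ∏ i, p k (a i)

lemma blockLaw_isLaw {ι : Type} {A : ι → Type} [∀ k, Fintype (A k)] {p : ∀ k, A k → ℝ} (hp : ∀ k, (∀ x, 0 ≤ p k x) ∧ ∑ x, p k x = 1)
    (n : ℕ) (k : ι) : (∀ x, 0 ≤ blockLaw p n k x) ∧ ∑ x, blockLaw p n k x = 1 := by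
  refine ⟨fun x => Finset.prod_nonneg fun i _ => (hp k).1 _, ?_⟩
  simp only [blockLaw]
  rw [← Fintype.prod_sum (fun (_ : Fin n) a => p k a)]
  exact Finset.prod_eq_one fun i _ => (hp k).2

lemma prodWeight_blockLaw (p : ∀ k, A k → ℝ) (n : ℕ) (x : ∀ k, Fin n → A k) :
    prodWeight (blockLaw p n) x = ∏ i, prodWeight p (fun k => x k i) :=
  Finset.prod_comm

variable [DecidableEq ι] [∀ k, Fintype (A k)]

lemma sum_blocks_prod {n : ℕ} (G : Fin n → (∀ k, A k) → ℝ) :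
    ∑ x : ∀ k, Fin n → A k, ∏ i, G i (fun k => x k i) = ∏ i, ∑ y, G i y := by
  rw [Fintype.prod_sum]
  exact Fintype.sum_equiv (Equiv.piComm fun k (_ : Fin n) => A k) _ _ fun x => rfl

lemma condAvg_blockLaw (p : ∀ k, A k → ℝ) {n : ℕ} (U : Finset ι)
    (G : Fin n → (∀ k, A k) → ℝ) (x : ∀ k, Fin n → A k) :
    condAvg (blockLaw p n) U (fun y => ∏ i, G i (fun k => y k i)) x =
      ∏ i, condAvg p U (G i) (fun k => x k i) := by
  simp only [condAvg]
  rw [← sum_blocks_prod]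
  refine Finset.sum_congr rfl fun y _ => ?_
  rw [prodWeight_blockLaw, ← Finset.prod_mul_distrib]
  refine Finset.prod_congr rfl fun i _ => ?_
  congr 2
  ext k
  by_cases hk : k ∈ U <;> simp [hk]

end Blocks

/-- Exponential Markov inequality in the form of a tilted sum: if `a` exceeds the mean of the
log-likelihood `logb 2 r`, then some positive tilt makes the tilted sum smaller than one. -/
lemma exists_tilt_lt_one {Ω : Type} [Fintype Ω] {q r : Ω → ℝ} (hq : ∑ ω, q ω = 1)
    (hr : ∀ ω, q ω ≠ 0 → 0 < r ω) {a : ℝ} (ha : ∑ ω, q ω * Real.logb 2 (r ω) < a) :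
    ∃ θ > (0 : ℝ), ∑ ω, q ω * (r ω ^ θ * (2 : ℝ) ^ (-(a * θ))) < 1 := by
  set d : Ω → ℝ := fun ω => Real.log (r ω) - a * Real.log 2 with hd
  have hder : HasDerivAt (fun θ : ℝ => ∑ ω, q ω * Real.exp (θ * d ω))
      (∑ ω, q ω * (Real.exp (0 * d ω) * (1 * d ω))) 0 :=
    HasDerivAt.fun_sum fun ω _ => (((hasDerivAt_id (0 : ℝ)).mul_const (d ω)).exp).const_mul (q ω)
  have hneg : ∑ ω, q ω * (Real.exp (0 * d ω) * (1 * d ω)) < 0 := by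
    have e : ∑ ω, q ω * (Real.exp (0 * d ω) * (1 * d ω)) =
        (∑ ω, q ω * Real.logb 2 (r ω) - (∑ ω, q ω) * a) * Real.log 2 := by
      rw [Finset.sum_mul, ← Finset.sum_sub_distrib, Finset.sum_mul]
      refine Finset.sum_congr rfl fun ω _ => ?_
      have : Real.log 2 ≠ 0 := (Real.log_pos one_lt_two).ne'
      simp only [hd, Real.logb]
      field_simp
      simp
    rw [e, hq]
    exact mul_neg_of_neg_of_pos (by linarith) (Real.log_pos one_lt_two)
  have hslope := hder.tendsto_slope_zero_right.eventually_lt_const hneg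
  obtain ⟨θ, hθ, hθ0⟩ := (hslope.and self_mem_nhdsWithin).exists
  have hθ0 : 0 < θ := hθ0
  refine ⟨θ, hθ0, ?_⟩
  have h1 : ∑ ω, q ω * (r ω ^ θ * (2 : ℝ) ^ (-(a * θ))) = ∑ ω, q ω * Real.exp (θ * d ω) := by
    refine Finset.sum_congr rfl fun ω _ => ?_
    by_cases h : q ω = 0
    · simp [h]
    rw [Real.rpow_def_of_pos (hr ω h), Real.rpow_def_of_pos two_pos, ← Real.exp_add]
    congr 2
    simp only [hd]
    ring
  rw [h1]
  simp only [smul_eq_mul, zero_add, zero_mul, Real.exp_zero, mul_one, hq] at hθ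
  have := (pos_iff_neg_of_mul_neg hθ).mp (inv_pos.mpr hθ0)
  linarith

lemma Hent_eq_sum {Ω α : Type} [Fintype Ω] [Fintype α] (p : Ω → ℝ) (X : Ω → α) :
    Hent p X = -∑ ω, p ω * Real.logb 2 (probOf p X (X ω)) := by
  rw [Hent]
  congr 1
  have : ∀ x, probOf p X x * Real.logb 2 (probOf p X x) =
      ∑ ω, if X ω = x then p ω * Real.logb 2 (probOf p X x) else 0 := by
    intro x
    nth_rw 1 [probOf]
    rw [Finset.sum_mul]
    exact Finset.sum_congr rfl fun ω _ => by split_ifs <;> simp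
  simp only [this]
  rw [Finset.sum_comm]
  refine Finset.sum_congr rfl fun ω _ => ?_
  simp

section Channel

variable {K : ℕ} {𝒳 : Fin K → Type} [∀ k, Fintype (𝒳 k)] {𝒵 : Type} [Fintype 𝒵]

lemma sum_joint_indicator {W : (∀ k, 𝒳 k) → 𝒵 → ℝ} {P : ∀ k, 𝒳 k → ℝ}
    (hP : ∀ k, (∀ x, 0 ≤ P k x) ∧ ∑ x, P k x = 1) (U : Finset (Fin K))
    (x : ∀ k, 𝒳 k) (z : 𝒵) :
    ∑ ω : (∀ j, 𝒳 j) × 𝒵, (if (∀ k ∈ U, ω.1 k = x k) ∧ ω.2 = z then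
        (∏ j, P j (ω.1 j)) * W ω.1 ω.2 else 0) =
      (∏ k ∈ U, P k (x k)) * condAvg P U (fun y => W y z) x := by
  rw [← sum_prodWeight_indicator_mul hP U, Fintype.sum_prod_type]
  refine Finset.sum_congr rfl fun y _ => ?_
  simp only [ite_and, prodWeight]
  split_ifs <;> simp

lemma sum_joint_indicator_input {W : (∀ k, 𝒳 k) → 𝒵 → ℝ}
    (hW : ∀ x, (∀ z, 0 ≤ W x z) ∧ ∑ z, W x z = 1) {P : ∀ k, 𝒳 k → ℝ}
    (hP : ∀ k, (∀ x, 0 ≤ P k x) ∧ ∑ x, P k x = 1) (U : Finset (Fin K))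
    (x : ∀ k, 𝒳 k) :
    ∑ ω : (∀ j, 𝒳 j) × 𝒵, (if ∀ k ∈ U, ω.1 k = x k then
        (∏ j, P j (ω.1 j)) * W ω.1 ω.2 else 0) = ∏ k ∈ U, P k (x k) := by
  rw [← sum_prodWeight_indicator hP U, Fintype.sum_prod_type]
  refine Finset.sum_congr rfl fun y _ => ?_
  simp only [prodWeight]
  split_ifs
  · rw [← Finset.mul_sum, (hW y).2]
  · simp

lemma ite_congr_of_iff {c d : Prop} {_ : Decidable c} {_ : Decidable d} (h : c ↔ d) (a b : ℝ) :
    (if c then a else b) = if d then a else b :=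
  if_congr h rfl rfl

lemma tup_eq_iff {Ω ι : Type} {B : ι → Type} (X : ∀ k, Ω → B k) (S : Finset ι) (ω ω' : Ω) :
    tup X S ω = tup X S ω' ↔ ∀ k ∈ S, X k ω = X k ω' := by
  simp [tup, funext_iff]

/-- Conditional mutual information as the mean of a log-likelihood ratio. -/
lemma IcondMut_eq_sum_logb {W : (∀ k, 𝒳 k) → 𝒵 → ℝ}
    (hW : ∀ x, (∀ z, 0 ≤ W x z) ∧ ∑ z, W x z = 1) {P : ∀ k, 𝒳 k → ℝ}
    (hP : ∀ k, (∀ x, 0 ≤ P k x) ∧ ∑ x, P k x = 1) (S B : Finset (Fin K)) :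
    IcondMut (fun ω : (∀ j, 𝒳 j) × 𝒵 => (∏ j, P j (ω.1 j)) * W ω.1 ω.2)
          (tup (fun k (ω : (∀ j, 𝒳 j) × 𝒵) => ω.1 k) S) (fun ω => ω.2)
          (tup (fun k (ω : (∀ j, 𝒳 j) × 𝒵) => ω.1 k) B) =
      ∑ ω : (∀ j, 𝒳 j) × 𝒵, (prodWeight P ω.1 * W ω.1 ω.2) *
        Real.logb 2 (condAvg P (S ∪ B) (fun y => W y ω.2) ω.1 /
          condAvg P B (fun y => W y ω.2) ω.1) := by
  set q : (∀ j, 𝒳 j) × 𝒵 → ℝ := fun ω => (∏ j, P j (ω.1 j)) * W ω.1 ω.2 with hq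
  set X : ∀ k, (∀ j, 𝒳 j) × 𝒵 → 𝒳 k := fun k ω => ω.1 k with hX
  have e1 : ∀ ω : (∀ j, 𝒳 j) × 𝒵,
      probOf q (fun ω => (tup X S ω, tup X B ω)) (tup X S ω, tup X B ω) =
        ∏ k ∈ S ∪ B, P k (ω.1 k) := by
    intro ω
    rw [← sum_joint_indicator_input hW hP, probOf]
    refine Finset.sum_congr rfl fun ω' _ => ite_congr_of_iff ?_ _ _
    rw [Prod.mk.injEq, tup_eq_iff, tup_eq_iff, Finset.forall_mem_union]
  have e2 : ∀ ω : (∀ j, 𝒳 j) × 𝒵, probOf q (tup X B) (tup X B ω) =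
        ∏ k ∈ B, P k (ω.1 k) := by
    intro ω
    rw [← sum_joint_indicator_input hW hP, probOf]
    refine Finset.sum_congr rfl fun ω' _ => ite_congr_of_iff ?_ _ _
    rw [tup_eq_iff]
  have e3 : ∀ ω : (∀ j, 𝒳 j) × 𝒵,
      probOf q (fun ω => (ω.2, tup X B ω)) (ω.2, tup X B ω) =
        (∏ k ∈ B, P k (ω.1 k)) * condAvg P B (fun y => W y ω.2) ω.1 := by
    intro ω
    rw [← sum_joint_indicator hP, probOf]
    refine Finset.sum_congr rfl fun ω' _ => ite_congr_of_iff ?_ _ _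
    rw [Prod.mk.injEq, tup_eq_iff, and_comm]
  have e4 : ∀ ω : (∀ j, 𝒳 j) × 𝒵,
      probOf q (fun ω => ((tup X S ω, ω.2), tup X B ω)) ((tup X S ω, ω.2), tup X B ω) =
        (∏ k ∈ S ∪ B, P k (ω.1 k)) * condAvg P (S ∪ B) (fun y => W y ω.2) ω.1 := by
    intro ω
    rw [← sum_joint_indicator hP, probOf]
    refine Finset.sum_congr rfl fun ω' _ => ite_congr_of_iff ?_ _ _
    rw [Prod.mk.injEq, Prod.mk.injEq, tup_eq_iff, tup_eq_iff, Finset.forall_mem_union]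
    tauto
  simp only [IcondMut, condHent, Hent_eq_sum, e1, e2, e3, e4]
  rw [← sub_eq_zero]
  simp only [sub_eq_add_neg, ← Finset.sum_neg_distrib, neg_neg, ← Finset.sum_add_distrib]
  refine Finset.sum_eq_zero fun ω _ => ?_
  by_cases h : q ω = 0
  · have h' : prodWeight P ω.1 * W ω.1 ω.2 = 0 := h
    rw [h, h']
    simp
  have h' : prodWeight P ω.1 * W ω.1 ω.2 = q ω := rfl
  have hpos : ∀ U, condAvg P U (fun y => W y ω.2) ω.1 ≠ 0 := fun U =>
    (condAvg_pos hP U (fun y => (hW y).1 _) h).ne'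
  have hPne : ∀ U : Finset (Fin K), ∏ k ∈ U, P k (ω.1 k) ≠ 0 := fun U =>
    Finset.prod_ne_zero_iff.mpr fun k _ =>
      Finset.prod_ne_zero_iff.mp (left_ne_zero_of_mul h) k (Finset.mem_univ k)
  rw [h', Real.logb_div (hpos _) (hpos _), Real.logb_mul (hPne _) (hpos _),
    Real.logb_mul (hPne _) (hpos _)]
  ring

lemma PoutPartial_eq_condAvg {𝒵 : Type} {W : (∀ k, 𝒳 k) → 𝒵 → ℝ} {P : ∀ k, 𝒳 k → ℝ}
    (hP : ∀ k, (∀ x, 0 ≤ P k x) ∧ ∑ x, P k x = 1) {Q : Fin K → ℝ} {K' : Finset (Fin K)} {n : ℕ}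
    (hM : ∀ k ∈ Finset.univ \ K', Msize Q n k = 1)
    (c : ∀ k, Fin (Msize Q n k) → Fin n → 𝒳 k) (m : ∀ k, Fin (Msize Q n k)) (z : Fin n → 𝒵) :
    PoutPartial W P Q K' n c z =
      condAvg (blockLaw P n) (Finset.univ \ K') (fun x => Wn W n x z) (fun k => c k (m k)) := by
  have hsub : Subsingleton (∀ k : (Finset.univ \ K' : Finset (Fin K)), Fin (Msize Q n k.1)) := by
    refine ⟨fun a b => funext fun k => Fin.ext ?_⟩
    have h1 := hM k.1 k.2
    have h2 := (a k).2
    have h3 := (b k).2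
    omega
  have hsum : ∀ G : (∀ k : (Finset.univ \ K' : Finset (Fin K)), Fin (Msize Q n k.1)) → ℝ,
      ∑ m', G m' = G (fun k => m k.1) := fun G => Fintype.sum_subsingleton G _
  rw [PoutPartial, Finset.prod_eq_one fun k hk => by rw [hM k hk, Nat.cast_one], inv_one, one_mul,
    hsum]
  have := sum_prodWeight_restrict (blockLaw_isLaw hP n) K' (fun x => Wn W n (fun k i =>
            if h : k ∈ K' then x ⟨k, h⟩ i else c k (m k) i) z)
  refine this.symm.trans ?_
  refine Finset.sum_congr rfl fun y _ => ?_
  congr 2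
  ext k i
  by_cases hk : k ∈ K' <;> simp [hk]

lemma prodWeight_mul_nonneg {W : (∀ k, 𝒳 k) → 𝒵 → ℝ}
    (hW : ∀ x, (∀ z, 0 ≤ W x z) ∧ ∑ z, W x z = 1) {P : ∀ k, 𝒳 k → ℝ}
    (hP : ∀ k, (∀ x, 0 ≤ P k x) ∧ ∑ x, P k x = 1) (ω : (∀ j, 𝒳 j) × 𝒵) :
    0 ≤ prodWeight P ω.1 * W ω.1 ω.2 :=
  mul_nonneg (prodWeight_nonneg hP _) ((hW _).1 _)

/-- Chernoff bound for the event that some likelihood ratio of a block is atypically large. -/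
lemma sum_atypical_le {W : (∀ k, 𝒳 k) → 𝒵 → ℝ}
    (hW : ∀ x, (∀ z, 0 ≤ W x z) ∧ ∑ z, W x z = 1) {P : ∀ k, 𝒳 k → ℝ}
    (hP : ∀ k, (∀ x, 0 ≤ P k x) ∧ ∑ x, P k x = 1) (B : Finset (Fin K))
    {a θ : Finset (Fin K) → ℝ} (hθ : ∀ U, B ⊂ U → 0 < θ U) (n : ℕ) :
    ∑ z : Fin n → 𝒵, ∑ x, prodWeight (blockLaw P n) x *
        (if condAvg (blockLaw P n) B (fun y => Wn W n y z) x = 0 ∨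
          ∃ U, B ⊂ U ∧ (2 : ℝ) ^ (n * a U) * condAvg (blockLaw P n) B (fun y => Wn W n y z) x <
            condAvg (blockLaw P n) U (fun y => Wn W n y z) x then Wn W n x z else 0) ≤
      ∑ U with B ⊂ U, (∑ ω : (∀ j, 𝒳 j) × 𝒵, (prodWeight P ω.1 * W ω.1 ω.2) *
        ((condAvg P U (fun y => W y ω.2) ω.1 / condAvg P B (fun y => W y ω.2) ω.1) ^ θ U *
          (2 : ℝ) ^ (-(a U * θ U)))) ^ n := by
  have hPn := blockLaw_isLaw hP n
  have hWn : ∀ x (z : Fin n → 𝒵), 0 ≤ Wn W n x z := fun x z =>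
    Finset.prod_nonneg fun i _ => (hW _).1 _
  have hcn : ∀ U x z, 0 ≤ condAvg P U (fun y => W y z) x := fun U x z =>
    condAvg_nonneg hP U (fun y => (hW y).1 z) x
  have hpow : ∀ U, (∑ ω : (∀ j, 𝒳 j) × 𝒵, (prodWeight P ω.1 * W ω.1 ω.2) *
        ((condAvg P U (fun y => W y ω.2) ω.1 / condAvg P B (fun y => W y ω.2) ω.1) ^ θ U *
          (2 : ℝ) ^ (-(a U * θ U)))) ^ n =
      ∑ z : Fin n → 𝒵, ∑ x : ∀ k, Fin n → 𝒳 k, prodWeight (blockLaw P n) x * Wn W n x z *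
        ((condAvg (blockLaw P n) U (fun y => Wn W n y z) x /
          condAvg (blockLaw P n) B (fun y => Wn W n y z) x) ^ θ U *
          ((2 : ℝ) ^ (-(a U * θ U))) ^ n) := by
    intro U
    rw [Fintype.sum_prod_type_right, Fintype.sum_pow]
    refine Finset.sum_congr rfl fun z _ => ?_
    rw [← sum_blocks_prod (A := 𝒳) (fun i y => (prodWeight P y * W y (z i)) *
        ((condAvg P U (fun y => W y (z i)) y / condAvg P B (fun y => W y (z i)) y) ^ θ U *
          (2 : ℝ) ^ (-(a U * θ U))))]
    refine Finset.sum_congr rfl fun x _ => ?_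
    simp only [Wn, condAvg_blockLaw P _ (fun i y => W y (z i)), prodWeight_blockLaw]
    rw [Finset.prod_mul_distrib, Finset.prod_mul_distrib, Finset.prod_mul_distrib,
      Real.finsetProd_rpow _ _ fun i _ => div_nonneg (hcn _ _ _) (hcn _ _ _),
      Finset.prod_div_distrib, Finset.prod_const, Finset.card_univ, Fintype.card_fin]
  simp only [hpow]
  refine le_trans (Finset.sum_le_sum fun z _ => ?_) (le_of_eq Finset.sum_comm)
  refine le_trans (Finset.sum_le_sum fun x _ => ?_) (le_of_eq Finset.sum_comm)
  set V := Wn W n x z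
  set VB := condAvg (blockLaw P n) B (fun y => Wn W n y z) x
  have hVU : ∀ U, 0 ≤ condAvg (blockLaw P n) U (fun y => Wn W n y z) x := fun U =>
    condAvg_nonneg hPn U (fun y => hWn y z) x
  have hpV : 0 ≤ prodWeight (blockLaw P n) x * V := mul_nonneg (prodWeight_nonneg hPn x) (hWn x z)
  have hterm : ∀ U, 0 ≤ prodWeight (blockLaw P n) x * V *
        ((condAvg (blockLaw P n) U (fun y => Wn W n y z) x / VB) ^ θ U *
          ((2 : ℝ) ^ (-(a U * θ U))) ^ n) := fun U =>
    mul_nonneg hpV (mul_nonneg (Real.rpow_nonneg (div_nonneg (hVU U) (hVU B)) _) (by positivity))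
  by_cases h0 : prodWeight (blockLaw P n) x * V = 0
  · refine le_trans (le_of_eq ?_) (Finset.sum_nonneg fun U _ => hterm U)
    rw [mul_ite, h0, mul_zero, ite_self]
  have hVB : 0 < VB := condAvg_pos hPn B (fun y => hWn y z) h0
  split_ifs with hbad
  · obtain ⟨U, hU, hlt⟩ := hbad.resolve_left hVB.ne'
    refine le_trans ?_ (Finset.single_le_sum (fun U _ => hterm U)
      (show U ∈ ({U | B ⊂ U} : Finset (Finset (Fin K))) by simpa using hU))
    refine le_mul_of_one_le_right hpV ?_
    have h1 : (2 : ℝ) ^ (n * a U) ≤ condAvg (blockLaw P n) U (fun y => Wn W n y z) x / VB :=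
      (le_div_iff₀ hVB).mpr hlt.le
    have h2 := Real.rpow_le_rpow (by positivity) h1 (hθ U hU).le
    refine le_trans (le_of_eq ?_) (mul_le_mul_of_nonneg_right h2 (by positivity))
    rw [← Real.rpow_natCast ((2 : ℝ) ^ _), ← Real.rpow_mul two_pos.le, ← Real.rpow_mul two_pos.le,
      ← Real.rpow_add two_pos]
    ring_nf
    simp
  · rw [mul_zero]
    exact Finset.sum_nonneg fun U _ => hterm U

lemma exists_pow_four_gt {α : Type} (T : Finset α) {b : α → ℝ} (hb : ∀ i ∈ T, b i < 1) :
    ∃ r : ℝ, 0 < r ∧ r < 1 ∧ ∀ i ∈ T, b i < r ^ 4 := by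
  have h1 : ∀ i ∈ T, ∀ᶠ r : ℝ in nhdsWithin 1 (Set.Iio 1), b i < r ^ 4 := by
    intro i hi
    have : Filter.Tendsto (fun r : ℝ => r ^ 4) (nhdsWithin 1 (Set.Iio 1)) (nhds (1 ^ 4)) :=
      ((continuous_pow 4).tendsto (1 : ℝ)).mono_left nhdsWithin_le_nhds
    rw [one_pow] at this
    exact this.eventually_const_lt (hb i hi)
  have h2 : ∀ᶠ r : ℝ in nhdsWithin 1 (Set.Iio 1), 0 < r :=
    (eventually_gt_nhds one_pos).filter_mono nhdsWithin_le_nhds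
  obtain ⟨r, hr, hr0, hr1⟩ :=
    (((Filter.eventually_all_finset T).mpr h1).and (h2.and self_mem_nhdsWithin)).exists
  exact ⟨r, hr0, hr1, hr⟩

end Channel

theorem stmt3 {K : ℕ} (hK : 1 ≤ K)
    {𝒳 : Fin K → Type} [∀ k, Fintype (𝒳 k)] {𝒵 : Type} [Fintype 𝒵]
    (W : (∀ k, 𝒳 k) → 𝒵 → ℝ) (hW : ∀ x, (∀ z, 0 ≤ W x z) ∧ ∑ z, W x z = 1)
    (P : ∀ k, 𝒳 k → ℝ) (hP : ∀ k, (∀ x, 0 ≤ P k x) ∧ ∑ x, P k x = 1)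
    (K' : Finset (Fin K)) (Q : Fin K → ℝ) (hQnn : ∀ k, 0 ≤ Q k)
    (hQ0 : ∀ k ∈ Finset.univ \ K', Q k = 0)
    (hQ : ∀ S ⊆ K', S.Nonempty →
      IcondMut (fun ω : (∀ j, 𝒳 j) × 𝒵 => (∏ j, P j (ω.1 j)) * W ω.1 ω.2)
          (tup (fun k (ω : (∀ j, 𝒳 j) × 𝒵) => ω.1 k) S) (fun ω => ω.2)
          (tup (fun k (ω : (∀ j, 𝒳 j) × 𝒵) => ω.1 k) (Finset.univ \ K')) <
        ∑ k ∈ S, Q k) :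
    ∃ ε > (0 : ℝ), ∃ N : ℕ, ∀ n ≥ N,
      ∑ c : ∀ k, Fin (Msize Q n k) → Fin n → 𝒳 k,
          cbProb P Q n c *
            ∑ z : Fin n → 𝒵, |PoutFull W Q n c z - PoutPartial W P Q K' n c z| ≤
        Real.exp (-(n * ε)) := by
  set B : Finset (Fin K) := Finset.univ \ K' with hBdef
  set T : Finset (Finset (Fin K)) := {U | B ⊂ U} with hT
  have hsum1 : ∑ ω : (∀ j, 𝒳 j) × 𝒵, prodWeight P ω.1 * W ω.1 ω.2 = 1 := by
    rw [Fintype.sum_prod_type]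
    simp only [← Finset.mul_sum, (hW _).2, mul_one, sum_prodWeight hP]
  have hrate : ∀ U, B ⊂ U → ∃ a θ : ℝ, 0 < θ ∧ a < ∑ k ∈ U, Q k ∧
      ∑ ω : (∀ j, 𝒳 j) × 𝒵, (prodWeight P ω.1 * W ω.1 ω.2) *
        ((condAvg P U (fun y => W y ω.2) ω.1 / condAvg P B (fun y => W y ω.2) ω.1) ^ θ *
          (2 : ℝ) ^ (-(a * θ))) < 1 := by
    intro U hU
    have hSU : U \ B ∪ B = U := Finset.sdiff_union_of_subset hU.subset
    have hSK : U \ B ⊆ K' := by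
      intro k hk
      simpa [hBdef] using (Finset.mem_sdiff.mp hk).2
    have hlt := hQ (U \ B) hSK (Finset.sdiff_nonempty.mpr hU.2)
    rw [IcondMut_eq_sum_logb hW hP, hSU] at hlt
    obtain ⟨a, ha1, ha2⟩ := exists_between hlt
    have hpos : ∀ ω : (∀ j, 𝒳 j) × 𝒵, prodWeight P ω.1 * W ω.1 ω.2 ≠ 0 →
        0 < condAvg P U (fun y => W y ω.2) ω.1 / condAvg P B (fun y => W y ω.2) ω.1 := fun ω h =>
      div_pos (condAvg_pos hP U (fun y => (hW y).1 _) h)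
        (condAvg_pos hP B (fun y => (hW y).1 _) h)
    obtain ⟨θ, hθ, hlt1⟩ := exists_tilt_lt_one hsum1 hpos ha1
    refine ⟨a, θ, hθ, ha2.trans_le ?_, hlt1⟩
    exact Finset.sum_le_sum_of_subset_of_nonneg Finset.sdiff_subset fun k _ _ => hQnn k
  choose! a θ hθ haQ hψ using hrate
  set ψ : Finset (Fin K) → ℝ := fun U => ∑ ω : (∀ j, 𝒳 j) × 𝒵, (prodWeight P ω.1 * W ω.1 ω.2) *
        ((condAvg P U (fun y => W y ω.2) ω.1 / condAvg P B (fun y => W y ω.2) ω.1) ^ θ U *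
          (2 : ℝ) ^ (-(a U * θ U))) with hψdef
  have hψ0 : ∀ U, 0 ≤ ψ U := fun U => Finset.sum_nonneg fun ω _ =>
    mul_nonneg (prodWeight_mul_nonneg hW hP ω) (mul_nonneg (Real.rpow_nonneg
      (div_nonneg (condAvg_nonneg hP U (fun y => (hW y).1 _) _)
        (condAvg_nonneg hP B (fun y => (hW y).1 _) _)) _) (by positivity))
  obtain ⟨r, hr0, hr1, hr⟩ := exists_pow_four_gt T
    (b := fun U => max (ψ U) ((2 : ℝ) ^ (a U - ∑ k ∈ U, Q k))) (by
      intro U hU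
      have hU' : B ⊂ U := by simpa [hT] using hU
      refine max_lt (hψ U hU') (Real.rpow_lt_one_of_one_lt_of_neg one_lt_two ?_)
      linarith [haQ U hU'])
  have hlim : Filter.Tendsto (fun n : ℕ => (3 * (T.card : ℝ) + 1) * r ^ n) Filter.atTop
      (nhds ((3 * (T.card : ℝ) + 1) * 0)) :=
    (tendsto_pow_atTop_nhds_zero_of_lt_one hr0.le hr1).const_mul _
  rw [mul_zero] at hlim
  obtain ⟨N, hN⟩ := Filter.eventually_atTop.mp (hlim.eventually_lt_const one_pos)
  refine ⟨-Real.log r, by linarith [Real.log_neg hr0 hr1], N, fun n hn => ?_⟩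
  have hexp : Real.exp (-(n * -Real.log r)) = r ^ n := by
    rw [mul_neg, neg_neg, Real.exp_nat_mul, Real.exp_log hr0]
  rw [hexp]
  have hM : ∀ k, 0 < Msize Q n k := fun k => Nat.ceil_pos.mpr (by positivity)
  have hMB : ∀ k ∈ B, Msize Q n k = 1 := fun k hk => by simp [Msize, hQ0 k hk]
  have hPn := blockLaw_isLaw hP n
  have hWn : ∀ (z : Fin n → 𝒵) x, 0 ≤ Wn W n x z := fun z x =>
    Finset.prod_nonneg fun i _ => (hW _).1 _
  have hMp : (∏ k, (Msize Q n k : ℝ)) ≠ 0 :=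
    Finset.prod_ne_zero_iff.mpr fun k _ => by exact_mod_cast (hM k).ne'
  have hdiff : ∀ (c : ∀ k, Fin (Msize Q n k) → Fin n → 𝒳 k) z,
      PoutFull W Q n c z - PoutPartial W P Q K' n c z = (∏ k, (Msize Q n k : ℝ))⁻¹ *
        ∑ m : ∀ k, Fin (Msize Q n k), ((fun x => Wn W n x z) (fun k => c k (m k)) -
          condAvg (blockLaw P n) B (fun x => Wn W n x z) (fun k => c k (m k))) := by
    intro c z
    have key : ∀ m : ∀ k, Fin (Msize Q n k),
        condAvg (blockLaw P n) B (fun x => Wn W n x z) (fun k => c k (m k)) =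
          PoutPartial W P Q K' n c z := fun m => (PoutPartial_eq_condAvg hP hMB c m z).symm
    simp only [key, Finset.sum_sub_distrib, mul_sub]
    rw [PoutFull, Finset.sum_const, Finset.card_univ, nsmul_eq_mul, Fintype.card_pi]
    simp only [Fintype.card_fin, Nat.cast_prod]
    rw [inv_mul_cancel_left₀ hMp]
  have hsumn : ∑ z : Fin n → 𝒵, ∑ x, prodWeight (blockLaw P n) x * Wn W n x z = 1 := by
    rw [Finset.sum_comm, ← sum_prodWeight hPn]
    refine Finset.sum_congr rfl fun x _ => ?_
    rw [← Finset.mul_sum]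
    simp only [Wn]
    rw [← Fintype.prod_sum (fun i z => W (fun k => x k i) z),
      Finset.prod_eq_one fun i _ => (hW _).2, mul_one]
  have hrn : 0 < r ^ n := pow_pos hr0 n
  have hratio : ∀ U ∈ T, (2 : ℝ) ^ (n * a U) / ∏ k ∈ U, (Msize Q n k : ℝ) ≤ (r ^ 4) ^ n := by
    intro U hU
    have h1 : (2 : ℝ) ^ (n * ∑ k ∈ U, Q k) ≤ ∏ k ∈ U, (Msize Q n k : ℝ) := by
      rw [Finset.mul_sum, Real.rpow_sum_of_pos two_pos]
      exact Finset.prod_le_prod (fun k _ => by positivity) fun k _ => Nat.le_ceil _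
    calc _ ≤ (2 : ℝ) ^ (n * a U) / (2 : ℝ) ^ (n * ∑ k ∈ U, Q k) := by gcongr
      _ = ((2 : ℝ) ^ (a U - ∑ k ∈ U, Q k)) ^ n := by
        rw [← Real.rpow_sub two_pos, ← mul_sub, mul_comm, Real.rpow_mul_natCast two_pos.le]
      _ ≤ _ := pow_le_pow_left₀ (by positivity) ((le_max_right _ _).trans (hr U hU).le) n
  calc _ = ∑ z : Fin n → 𝒵, ∑ c : ∀ k, Fin (Msize Q n k) → Fin n → 𝒳 k,
        (∏ k, ∏ j, blockLaw P n k (c k j)) *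
          |PoutFull W Q n c z - PoutPartial W P Q K' n c z| := by
        rw [Finset.sum_comm]
        simp only [Finset.mul_sum]
        rfl
    _ ≤ ∑ z : Fin n → 𝒵, _ := Finset.sum_le_sum fun z _ => by
        simp only [hdiff]
        exact soft_covering_one_shot hPn hM hMB (hWn z) (l := fun U => (2 : ℝ) ^ (n * a U))
          (fun U => by positivity) (pow_pos hrn 2)
    _ ≤ 2 * ∑ U ∈ T, ψ U ^ n + ((r ^ n) ^ 2 + ((r ^ n) ^ 2)⁻¹ *
          ∑ U ∈ T, (2 : ℝ) ^ (n * a U) / ∏ k ∈ U, (Msize Q n k : ℝ)) := by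
        rw [Finset.sum_add_distrib, ← Finset.mul_sum, ← Finset.mul_sum, hsumn, mul_one]
        exact add_le_add (mul_le_mul_of_nonneg_left (sum_atypical_le hW hP B hθ n) two_pos.le)
          le_rfl
    _ ≤ 2 * ∑ U ∈ T, (r ^ n) ^ 2 + ((r ^ n) ^ 2 + ((r ^ n) ^ 2)⁻¹ * ∑ U ∈ T, (r ^ n) ^ 4) := by
        have hr1n : r ^ n ≤ 1 := pow_le_one₀ hr0.le hr1.le
        have e4 : (r ^ 4) ^ n = (r ^ n) ^ 4 := by rw [← pow_mul, ← pow_mul, mul_comm]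
        gcongr with U hU U hU
        · calc ψ U ^ n ≤ (r ^ 4) ^ n :=
                pow_le_pow_left₀ (hψ0 U) ((le_max_left _ _).trans (hr U hU).le) n
            _ = (r ^ n) ^ 4 := e4
            _ ≤ (r ^ n) ^ 2 := pow_le_pow_of_le_one hrn.le hr1n (by norm_num)
        · exact (hratio U hU).trans e4.le
    _ = ((3 * (T.card : ℝ) + 1) * r ^ n) * r ^ n := by
        rw [Finset.sum_const, Finset.sum_const, nsmul_eq_mul, nsmul_eq_mul]
        field_simp
        ring
    _ ≤ 1 * r ^ n := mul_le_mul_of_nonneg_right (hN n hn).le hrn.le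
    _ = r ^ n := one_mul _
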